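/- Set f(t) = √(1 − 4t²) and λ = (4t² − 2t + (2s − 1)(1 + f(t))) / (2(t − s)). Then λ > 1, and the vectors v₁ = (1 + f(t), 2t) and v₂ = (2t, 1 + f(t)) are eigenvectors of B with B(v₁) = λ·v₁ and B(v₂) = λ⁻¹·v₂. -/

import Mathlib

open Real Set Filter

noncomputable section

/-- A point in the plane. -/
abbrev Pt : Type := ℝ × ℝ

/-- The linear map `B` with matrix `(1/(t-s)) ⬝ [[t² - (1-s)², (1-2s)t], [(2s-1)t, (2t-1)t]]`. -/
def Bmap (s t : ℝ) : Pt → Pt := fun p =>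
  ((1/(t-s)) * ((t^2 - (1-s)^2) * p.1 + (1-2*s)*t * p.2),
   (1/(t-s)) * ((2*s-1)*t * p.1 + (2*t-1)*t * p.2))

/-- The quadratic form `Q_B(x,y) = t(x² + y²) - xy`. -/
def QB (t : ℝ) (p : Pt) : ℝ := t * (p.1^2 + p.2^2) - p.1 * p.2

/-- With `f(t) = √(1-4t²)` and
`λ = (4t² - 2t + (2s-1)(1+f(t))) / (2(t-s))`, one has `λ > 1`, and
`v₁ = (1+f(t), 2t)`, `v₂ = (2t, 1+f(t))` are eigenvectors of `B` with eigenvalues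
`λ` and `λ⁻¹` respectively. -/
theorem Bmap_eigenvectors (t : ℝ) (ht : t ∈ Ioo (0:ℝ) (1/2))
    (s : ℝ) (hs : s = Real.sqrt (t - t^2))
    (f lam : ℝ) (hf : f = Real.sqrt (1 - 4*t^2))
    (hlam : lam = (4*t^2 - 2*t + (2*s - 1)*(1 + f)) / (2*(t - s))) :
    1 < lam ∧
    Bmap s t ((1 + f, 2*t) : Pt) = lam • ((1 + f, 2*t) : Pt) ∧
    Bmap s t ((2*t, 1 + f) : Pt) = lam⁻¹ • ((2*t, 1 + f) : Pt) := by
  obtain ⟨h0, h1⟩ := ht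
  have s_sq : s ^ 2 = t - t ^ 2 := by rw [hs]; exact Real.sq_sqrt (by nlinarith)
  have f_sq : f ^ 2 = 1 - 4 * t ^ 2 := by rw [hf]; exact Real.sq_sqrt (by nlinarith)
  have s_nonneg : 0 ≤ s := hs ▸ Real.sqrt_nonneg _
  have f_nonneg : 0 ≤ f := hf ▸ Real.sqrt_nonneg _
  have t_lt_s : t < s := by nlinarith
  have s_lt_half : s < 1 / 2 := by nlinarith [sub_pos.2 h1]
  have hne : t - s ≠ 0 := by linarith
  have lam_gt : 1 < lam := by
    have h : lam - 1 = (1 - 2 * s) * (1 - 2 * s + f) / (2 * (s - t)) := by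
      have hne' : s - t ≠ 0 := by linarith
      rw [hlam]
      field_simp
      grind
    have : 0 < lam - 1 := by
      rw [h]
      have := sub_pos.2 t_lt_s
      have : 0 < 1 - 2 * s := by linarith
      positivity
    linarith
  have lam_inv : lam⁻¹ = (4 * t ^ 2 - 2 * t + (2 * s - 1) * (1 - f)) / (2 * (t - s)) := by
    refine inv_eq_of_mul_eq_one_right ?_
    rw [hlam]
    field_simp
    grind
  refine ⟨lam_gt, ?_, ?_⟩
  · ext <;> simp only [Bmap, Prod.smul_mk, smul_eq_mul, hlam] <;> field_simp <;> grind
  · ext <;> simp only [Bmap, Prod.smul_mk, smul_eq_mul, lam_inv] <;> field_simp <;> grind
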